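/- arXiv:1311.0028 — 3 statements merged into one kernel-verified Lean document; each statement's English description precedes it below -/
import Mathlib

section
/- For every integer N ≥ 5 and every integer k with 1 ≤ k ≤ ⌊(N−1)/2⌋ − 1, the LGL interval length satisfies 2·sin((π/2)·(4kN+k+3N+1)/(N(2N+1)))·sin((π/2)·(N+k+1)/(N(2N+1))) ≤ |Δ_k^N| ≤ 2·sin((π/2)·(4kN+3N+k)/(N(2N+1)))·sin((π/2)·(3N−k)/(N(2N+1))). -/
/-- The Legendre polynomial of degree `N` via the Rodrigues formula. -/
noncomputable def legendrePoly (N : ℕ) : Polynomial ℝ :=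
  Polynomial.C (1 / (2 ^ N * N.factorial : ℝ)) *
    Polynomial.derivative^[N] ((Polynomial.X ^ 2 - 1) ^ N)

/-- The polynomial `(1 - x²)·L_N'(x)` whose zeros are the LGL nodes of order `N`. -/
noncomputable def lglPoly (N : ℕ) : Polynomial ℝ :=
  (1 - Polynomial.X ^ 2) * Polynomial.derivative (legendrePoly N)

/-- `ξ 0 < ξ 1 < ⋯ < ξ N` enumerates the Legendre-Gauss-Lobatto nodes of order `N`
in increasing order. -/
def IsLGLNodes (N : ℕ) (ξ : ℕ → ℝ) : Prop :=
  StrictMonoOn ξ (Set.Iic N) ∧ ξ 0 = -1 ∧ ξ N = 1 ∧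
    (∀ k ≤ N, (lglPoly N).eval (ξ k) = 0) ∧
    (∀ x : ℝ, (lglPoly N).eval x = 0 → ∃ k ≤ N, ξ k = x)


open Polynomial in
/-- The iterated derivatives of `(X² - 1)^N` satisfy a second order recurrence. -/
lemma iterate_derivative_sq_sub_one_pow (N n : ℕ) :
    ((X : ℝ[X]) ^ 2 - 1) * derivative^[n + 2] ((X ^ 2 - 1) ^ N) +
      (2 * (n + 1) - 2 * N : ℝ[X]) * X * derivative^[n + 1] ((X ^ 2 - 1) ^ N) +
      ((n + 1) * n - 2 * N * (n + 1) : ℝ[X]) * derivative^[n] ((X ^ 2 - 1) ^ N) = 0 := by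
  induction n with
  | zero =>
    have h : ((X : ℝ[X]) ^ 2 - 1) * derivative ((X ^ 2 - 1) ^ N) =
        2 * (N : ℝ[X]) * X * (X ^ 2 - 1) ^ N := by
      rcases N with _ | M
      · simp
      · simp only [derivative_pow, derivative_sub, derivative_X, derivative_one]
        simp only [Nat.add_sub_cancel, map_natCast, Nat.cast_add, Nat.cast_one]
        simp
        ring
    have h' := congrArg derivative h
    simp only [derivative_mul, derivative_sub, derivative_X_pow, derivative_one,
      derivative_natCast, derivative_X, derivative_ofNat] at h'
    simp only [Function.iterate_succ, Function.iterate_zero, Function.comp, id]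
    simp at h' ⊢
    rw [show (C 2 : ℝ[X]) = 2 from rfl] at h'
    linear_combination h'
  | succ n ih =>
    have h' := congrArg derivative ih
    simp only [derivative_mul, derivative_add, derivative_sub, derivative_X_pow, derivative_one,
      derivative_natCast, derivative_X, derivative_ofNat, ← Function.iterate_succ_apply',
      derivative_zero] at h'
    simp at h' ⊢
    rw [show (C 2 : ℝ[X]) = 2 from rfl] at h'
    linear_combination h'

open Polynomial in
/-- The differential equation satisfied by the derivative of a Legendre polynomial. -/
lemma eval_derivative_legendrePoly_ode (N : ℕ) (x : ℝ) :
    (1 - x ^ 2) * (derivative^[3] (legendrePoly N)).eval x -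
      4 * x * (derivative^[2] (legendrePoly N)).eval x +
      (N * (N + 1) - 2) * (derivative (legendrePoly N)).eval x = 0 := by
  have h := congrArg (eval x) (iterate_derivative_sq_sub_one_pow N (N + 1))
  have e (j : ℕ) : derivative^[j] (legendrePoly N) =
      C (1 / (2 ^ N * N.factorial : ℝ)) * derivative^[N + j] ((X ^ 2 - 1) ^ N) := by
    rw [legendrePoly, iterate_derivative_C_mul, ← Function.iterate_add_apply, add_comm]
  have e1 := e 1
  rw [Function.iterate_one] at e1
  rw [e 3, e 2, e1]
  simp only [eval_mul, eval_add, eval_sub, eval_C, eval_X, eval_pow, eval_one, eval_natCast,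
    eval_ofNat, eval_zero] at h ⊢
  push_cast at h
  simp only [add_assoc, Nat.reduceAdd] at h ⊢
  linear_combination (-(1 / (2 ^ N * N.factorial : ℝ))) * h

open Polynomial in
lemma iterate_derivative_comp_neg_X {p : ℝ[X]} (hp : p.comp (-X) = p) (n : ℕ) :
    (derivative^[n] p).comp (-X) = (-1) ^ n * derivative^[n] p := by
  induction n with
  | zero => simpa using hp
  | succ n ih =>
    have h := congrArg derivative ih
    rw [derivative_comp] at h
    rw [Function.iterate_succ_apply']
    simp only [derivative_neg, derivative_X, derivative_mul] at h
    have : derivative ((-1 : ℝ[X]) ^ n) = 0 := by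
      rw [show ((-1 : ℝ[X]) ^ n) = C ((-1) ^ n) by simp, derivative_C]
    rw [this] at h
    linear_combination -h

open Polynomial in
lemma eval_neg_lglPoly_eq_zero {N : ℕ} {x : ℝ} (hx : (lglPoly N).eval x = 0) :
    (lglPoly N).eval (-x) = 0 := by
  have e : derivative (legendrePoly N) =
      C (1 / (2 ^ N * N.factorial : ℝ)) * derivative^[N + 1] ((X ^ 2 - 1) ^ N) := by
    rw [legendrePoly, derivative_C_mul, Function.iterate_succ_apply']
  have h := congrArg (eval x)
    (iterate_derivative_comp_neg_X (p := ((X : ℝ[X]) ^ 2 - 1) ^ N) (by simp) (N + 1))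
  rw [lglPoly, e] at hx ⊢
  simp only [eval_comp, eval_neg, eval_X, eval_mul, eval_pow, eval_one, eval_sub, eval_C]
    at h hx ⊢
  rw [h]
  linear_combination (-1 : ℝ) ^ (N + 1) * hx

lemma IsLGLNodes.symm {N : ℕ} {ξ : ℕ → ℝ} (hξ : IsLGLNodes N ξ) {k : ℕ} (hk : k ≤ N) :
    ξ (N - k) = -ξ k := by
  obtain ⟨hmono, -, -, hzero, hall⟩ := hξ
  have hf : StrictMono (fun i : Fin (N + 1) => ξ i) := fun i j hij =>
    hmono (Nat.lt_succ_iff.mp i.2) (Nat.lt_succ_iff.mp j.2) hij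
  have hg : StrictMono (fun i : Fin (N + 1) => -ξ (N - i)) := fun i j hij => by
    have : (i : ℕ) < j := hij
    exact neg_lt_neg (hmono (Nat.sub_le _ _) (Nat.sub_le _ _) (by omega))
  have hr : Set.range (fun i : Fin (N + 1) => ξ i) =
      Set.range (fun i : Fin (N + 1) => -ξ (N - i)) := by
    ext x
    constructor
    · rintro ⟨i, rfl⟩
      obtain ⟨j, hj, hj'⟩ := hall _ (eval_neg_lglPoly_eq_zero (hzero i (by omega)))
      refine ⟨⟨N - j, by omega⟩, ?_⟩
      simp only [Nat.sub_sub_self hj, hj', neg_neg]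
    · rintro ⟨i, rfl⟩
      obtain ⟨j, hj, hj'⟩ := hall _ (eval_neg_lglPoly_eq_zero (hzero (N - i) (by omega)))
      exact ⟨⟨j, by omega⟩, hj'⟩
  have := congrFun ((hf.range_inj hg).mp hr) ⟨k, by omega⟩
  simp only at this
  rw [this, neg_neg]

open Set in
lemma sturm_comparison_pos {u u' v v' q r : ℝ → ℝ} {a b : ℝ} (hab : a < b)
    (hu : ContinuousOn u (Icc a b)) (hv : ContinuousOn v (Icc a b))
    (hu' : ∀ x ∈ Ioo a b, HasDerivAt u (u' x) x)
    (hu'' : ∀ x ∈ Ioo a b, HasDerivAt u' (-(q x * u x)) x)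
    (hv' : ∀ x ∈ Ioo a b, HasDerivAt v (v' x) x)
    (hv'' : ∀ x ∈ Ioo a b, HasDerivAt v' (-(r x * v x)) x)
    (hua : u a = 0) (hub : u b = 0) (hv0 : ∀ x ∈ Icc a b, v x ≠ 0)
    (hpos : ∀ x ∈ Ioo a b, 0 < u x / v x) (hqr : ∀ x ∈ Ioo a b, q x ≤ r x) : False := by
  have hg : ContinuousOn (fun x => u x / v x) (Icc a b) := hu.div hv hv0
  have hg' : ∀ x ∈ Ioo a b, HasDerivAt (fun x => u x / v x)
      ((u' x * v x - u x * v' x) / v x ^ 2) x := fun x hx =>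
    (hu' x hx).div (hv' x hx) (hv0 x (Ioo_subset_Icc_self hx))
  have hW' : ∀ x ∈ Ioo a b, HasDerivAt (fun x => u' x * v x - u x * v' x)
      ((r x - q x) * (u x * v x)) x := fun x hx => by
    refine (((hu'' x hx).mul (hv' x hx)).sub ((hu' x hx).mul (hv'' x hx))).congr_deriv ?_
    ring
  have hW : MonotoneOn (fun x => u' x * v x - u x * v' x) (Ioo a b) := by
    apply monotoneOn_of_deriv_nonneg (convex_Ioo a b)
    · exact fun x hx => (hW' x hx).continuousAt.continuousWithinAt
    · rw [interior_Ioo]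
      exact fun x hx => (hW' x hx).differentiableAt.differentiableWithinAt
    · rw [interior_Ioo]
      intro x hx
      rw [(hW' x hx).deriv]
      have hne := hv0 x (Ioo_subset_Icc_self hx)
      have : u x * v x = u x / v x * v x ^ 2 := by field_simp
      rw [this]
      exact mul_nonneg (sub_nonneg.mpr (hqr x hx))
        (mul_nonneg (hpos x hx).le (sq_nonneg _))
  obtain ⟨c, hc, hc0⟩ := exists_hasDerivAt_eq_zero hab hg (by simp [hua, hub]) hg'
  have hWc : u' c * v c - u c * v' c = 0 := by
    have hne := hv0 c (Ioo_subset_Icc_self hc)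
    simpa [hne] using hc0
  have hmono : MonotoneOn (fun x => u x / v x) (Icc c b) := by
    apply monotoneOn_of_deriv_nonneg (convex_Icc c b)
      (hg.mono (Icc_subset_Icc_left hc.1.le))
    · rw [interior_Icc]
      exact fun x hx =>
        (hg' x ⟨hc.1.trans hx.1, hx.2⟩).differentiableAt.differentiableWithinAt
    · rw [interior_Icc]
      intro x hx
      have hx' : x ∈ Ioo a b := ⟨hc.1.trans hx.1, hx.2⟩
      rw [(hg' x hx').deriv]
      have := hW hc hx' hx.1.le
      simp only [hWc] at this
      positivity
  have h1 := hmono (left_mem_Icc.mpr hc.2.le) (right_mem_Icc.mpr hc.2.le) hc.2.le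
  have h2 := hpos c hc
  simp only [hub, zero_div] at h1
  linarith

open Set in
/-- Sturm comparison: if `u'' = -q u`, `v'' = -r v` with `q ≤ r`, then `v` vanishes somewhere
between two consecutive zeros of `u`, endpoints included. -/
theorem sturm_comparison {u u' v v' q r : ℝ → ℝ} {a b : ℝ} (hab : a < b)
    (hu : ContinuousOn u (Icc a b)) (hv : ContinuousOn v (Icc a b))
    (hu' : ∀ x ∈ Ioo a b, HasDerivAt u (u' x) x)
    (hu'' : ∀ x ∈ Ioo a b, HasDerivAt u' (-(q x * u x)) x)
    (hv' : ∀ x ∈ Ioo a b, HasDerivAt v (v' x) x)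
    (hv'' : ∀ x ∈ Ioo a b, HasDerivAt v' (-(r x * v x)) x)
    (hua : u a = 0) (hub : u b = 0) (hu0 : ∀ x ∈ Ioo a b, u x ≠ 0)
    (hqr : ∀ x ∈ Ioo a b, q x ≤ r x) : ∃ x ∈ Icc a b, v x = 0 := by
  by_contra! hv0
  have hg : ContinuousOn (fun x => u x / v x) (Ioo a b) :=
    (hu.div hv hv0).mono Ioo_subset_Icc_self
  have hg0 : ∀ x ∈ Ioo a b, u x / v x ≠ 0 := fun x hx =>
    div_ne_zero (hu0 x hx) (hv0 x (Ioo_subset_Icc_self hx))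
  by_cases hpos : ∀ x ∈ Ioo a b, 0 < u x / v x
  · exact sturm_comparison_pos hab hu hv hu' hu'' hv' hv'' hua hub hv0 hpos hqr
  · push Not at hpos
    obtain ⟨y, hy, hy0⟩ := hpos
    have hneg : ∀ x ∈ Ioo a b, u x / v x < 0 := by
      intro x hx
      by_contra! hx0
      obtain ⟨z, hz, hz0⟩ := isPreconnected_Ioo.intermediate_value hy hx hg ⟨hy0, hx0⟩
      exact hg0 z hz hz0
    refine sturm_comparison_pos (u := fun x => -u x) (u' := fun x => -u' x) (q := q) hab
      hu.neg hv (fun x hx => (hu' x hx).neg) (fun x hx => ?_) hv' hv'' (by simp [hua])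
      (by simp [hub]) hv0 (fun x hx => ?_) hqr
    · exact (hu'' x hx).neg.congr_deriv (by ring)
    · rw [neg_div]
      exact neg_pos.mpr (hneg x hx)

/-- The Liouville normal form `sin^{3/2} θ · L_N'(-cos θ)` of the derivative of the Legendre
polynomial. -/
noncomputable def lglLiouville (N : ℕ) (θ : ℝ) : ℝ :=
  Real.sin θ ^ (3 / 2 : ℝ) * (Polynomial.derivative (legendrePoly N)).eval (-Real.cos θ)

/-- The derivative of `lglLiouville N`. -/
noncomputable def lglLiouvilleDeriv (N : ℕ) (θ : ℝ) : ℝ :=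
  3 / 2 * Real.sin θ ^ (1 / 2 : ℝ) * Real.cos θ *
      (Polynomial.derivative (legendrePoly N)).eval (-Real.cos θ) +
    Real.sin θ ^ (5 / 2 : ℝ) *
      (Polynomial.derivative^[2] (legendrePoly N)).eval (-Real.cos θ)

/-- The potential in the differential equation of `lglLiouville N`. -/
noncomputable def lglPotential (N : ℕ) (θ : ℝ) : ℝ :=
  ((N : ℝ) + 1 / 2) ^ 2 - 3 / 4 / Real.sin θ ^ 2

lemma continuous_lglLiouville (N : ℕ) : Continuous (lglLiouville N) := by
  unfold lglLiouville
  exact (Real.continuous_sin.rpow_const fun _ => Or.inr (by norm_num)).mul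
    ((Polynomial.continuous _).comp Real.continuous_cos.neg)

lemma hasDerivAt_eval_neg_cos (p : Polynomial ℝ) (θ : ℝ) :
    HasDerivAt (fun θ => p.eval (-Real.cos θ))
      (p.derivative.eval (-Real.cos θ) * Real.sin θ) θ := by
  have := (p.hasDerivAt (-Real.cos θ)).comp θ (Real.hasDerivAt_cos θ).neg
  simpa [Function.comp_def] using this

lemma hasDerivAt_lglLiouville (N : ℕ) {θ : ℝ} (hθ : 0 < Real.sin θ) :
    HasDerivAt (lglLiouville N) (lglLiouvilleDeriv N θ) θ := by
  have h := ((Real.hasDerivAt_sin θ).rpow_const (p := 3 / 2) (Or.inl hθ.ne')).mul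
    (hasDerivAt_eval_neg_cos (Polynomial.derivative (legendrePoly N)) θ)
  refine h.congr_deriv ?_
  unfold lglLiouvilleDeriv
  have e : Real.sin θ ^ (5 / 2 : ℝ) = Real.sin θ ^ (3 / 2 : ℝ) * Real.sin θ := by
    rw [← Real.rpow_add_one hθ.ne']; norm_num
  rw [e]
  norm_num
  ring

lemma hasDerivAt_lglLiouvilleDeriv (N : ℕ) {θ : ℝ} (hθ : 0 < Real.sin θ) :
    HasDerivAt (lglLiouvilleDeriv N) (-(lglPotential N θ * lglLiouville N θ)) θ := by
  have h1 := ((((Real.hasDerivAt_sin θ).rpow_const (p := 1 / 2) (Or.inl hθ.ne')).const_mul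
    (3 / 2)).mul (Real.hasDerivAt_cos θ)).mul
      (hasDerivAt_eval_neg_cos (Polynomial.derivative (legendrePoly N)) θ)
  have h2 := ((Real.hasDerivAt_sin θ).rpow_const (p := 5 / 2) (Or.inl hθ.ne')).mul
    (hasDerivAt_eval_neg_cos (Polynomial.derivative^[2] (legendrePoly N)) θ)
  refine (h1.add h2).congr_deriv ?_
  have ode := eval_derivative_legendrePoly_ode N (-Real.cos θ)
  simp only [Function.iterate_succ_apply', Function.iterate_zero, id, Pi.mul_apply] at ode ⊢
  unfold lglPotential lglLiouville
  set s := Real.sin θ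
  set c := Real.cos θ
  set p0 := Polynomial.eval (-c) (Polynomial.derivative (legendrePoly N))
  set p1 := Polynomial.eval (-c) (Polynomial.derivative (Polynomial.derivative (legendrePoly N)))
  set p2 := Polynomial.eval (-c)
    (Polynomial.derivative (Polynomial.derivative (Polynomial.derivative (legendrePoly N))))
  have hsc : s ^ 2 + c ^ 2 = 1 := Real.sin_sq_add_cos_sq θ
  have e1 : s ^ (1 / 2 : ℝ) = s ^ (-1 / 2 : ℝ) * s := by
    rw [← Real.rpow_add_one hθ.ne']; norm_num
  have e3 : s ^ (3 / 2 : ℝ) = s ^ (-1 / 2 : ℝ) * s ^ 2 := by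
    rw [← Real.rpow_add_natCast hθ.ne']; norm_num
  have e5 : s ^ (5 / 2 : ℝ) = s ^ (-1 / 2 : ℝ) * s ^ 3 := by
    rw [← Real.rpow_add_natCast hθ.ne']; norm_num
  have f1 : (1 / 2 - 1 : ℝ) = -1 / 2 := by norm_num
  have f2 : (5 / 2 - 1 : ℝ) = 3 / 2 := by norm_num
  rw [f1, f2, e1, e3, e5]
  set t := s ^ (-1 / 2 : ℝ)
  have hs : s ≠ 0 := hθ.ne'
  have hdiv : -((((N : ℝ) + 1 / 2) ^ 2 - 3 / 4 / s ^ 2) * (t * s ^ 2 * p0)) =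
      -(((N : ℝ) + 1 / 2) ^ 2 * s ^ 2 - 3 / 4) * (t * p0) := by
    field_simp
  rw [hdiv]
  linear_combination t * s ^ 2 * ode + (3 / 4 * t * p0 + t * s ^ 2 * p2) * hsc

lemma lglLiouville_eq_zero_iff (N : ℕ) {θ : ℝ} (h0 : 0 ≤ θ) (hπ : θ ≤ Real.pi) :
    lglLiouville N θ = 0 ↔ (lglPoly N).eval (-Real.cos θ) = 0 := by
  have hs := Real.sin_nonneg_of_nonneg_of_le_pi h0 hπ
  have hsc : 1 - (-Real.cos θ) ^ 2 = Real.sin θ ^ 2 := by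
    linarith [Real.sin_sq_add_cos_sq θ]
  unfold lglLiouville lglPoly
  simp only [Polynomial.eval_mul, Polynomial.eval_sub, Polynomial.eval_one, Polynomial.eval_pow,
    Polynomial.eval_X, hsc, mul_eq_zero, Real.rpow_eq_zero hs (by norm_num : (3 / 2 : ℝ) ≠ 0),
    pow_eq_zero_iff (two_ne_zero)]

/-- The angles `θ ∈ [0, π]` with `-cos θ = ξ k`. -/
noncomputable def lglAngle (ξ : ℕ → ℝ) (k : ℕ) : ℝ := Real.arccos (-ξ k)

namespace IsLGLNodes

variable {N : ℕ} {ξ : ℕ → ℝ}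

lemma mem_Icc (hξ : IsLGLNodes N ξ) {k : ℕ} (hk : k ≤ N) : ξ k ∈ Set.Icc (-1) 1 := by
  obtain ⟨hmono, h0, hN, -, -⟩ := hξ
  constructor
  · rw [← h0]; exact hmono.monotoneOn (Nat.zero_le N) hk (Nat.zero_le k)
  · rw [← hN]; exact hmono.monotoneOn hk (le_refl N) hk

lemma cos_lglAngle (hξ : IsLGLNodes N ξ) {k : ℕ} (hk : k ≤ N) :
    Real.cos (lglAngle ξ k) = -ξ k := by
  have h := hξ.mem_Icc hk
  exact Real.cos_arccos (by linarith [h.2]) (by linarith [h.1])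

lemma lglAngle_lt (hξ : IsLGLNodes N ξ) {j k : ℕ} (hjk : j < k) (hk : k ≤ N) :
    lglAngle ξ j < lglAngle ξ k := by
  have hj := hξ.mem_Icc (hjk.le.trans hk)
  have hk' := hξ.mem_Icc hk
  exact Real.strictAntiOn_arccos ⟨by linarith [hk'.2], by linarith [hk'.1]⟩
    ⟨by linarith [hj.2], by linarith [hj.1]⟩ (neg_lt_neg (hξ.1 (hjk.le.trans hk) hk hjk))

lemma lglAngle_zero (hξ : IsLGLNodes N ξ) : lglAngle ξ 0 = 0 := by
  simp [lglAngle, hξ.2.1]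

lemma lglAngle_symm (hξ : IsLGLNodes N ξ) {k : ℕ} (hk : k ≤ N) :
    lglAngle ξ (N - k) = Real.pi - lglAngle ξ k := by
  rw [lglAngle, lglAngle, hξ.symm hk, Real.arccos_neg (-ξ k)]

lemma lglLiouville_lglAngle (hξ : IsLGLNodes N ξ) {k : ℕ} (hk : k ≤ N) :
    lglLiouville N (lglAngle ξ k) = 0 := by
  rw [lglAngle, lglLiouville_eq_zero_iff N (Real.arccos_nonneg _) (Real.arccos_le_pi _),
    ← lglAngle, hξ.cos_lglAngle hk, neg_neg]
  exact hξ.2.2.2.1 k hk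

lemma lglLiouville_ne_zero (hξ : IsLGLNodes N ξ) {k : ℕ} (hk : k < N) {θ : ℝ}
    (hθ : θ ∈ Set.Ioo (lglAngle ξ k) (lglAngle ξ (k + 1))) : lglLiouville N θ ≠ 0 := by
  have h0 : 0 ≤ θ := (Real.arccos_nonneg _).trans hθ.1.le
  have hπ : θ ≤ Real.pi := hθ.2.le.trans (Real.arccos_le_pi _)
  rw [Ne, lglLiouville_eq_zero_iff N h0 hπ]
  intro h
  obtain ⟨j, hj, hj'⟩ := hξ.2.2.2.2 _ h
  have hθj : lglAngle ξ j = θ := by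
    rw [lglAngle, hj', neg_neg, Real.arccos_cos h0 hπ]
  rw [← hθj] at hθ
  rcases Nat.lt_or_ge k j with h1 | h1
  · rcases Nat.lt_or_ge (k + 1) j with h2 | h2
    · exact absurd (hξ.lglAngle_lt h2 hj) (not_lt.mpr hθ.2.le)
    · obtain rfl : j = k + 1 := by omega
      exact lt_irrefl _ hθ.2
  · rcases h1.lt_or_eq with h2 | rfl
    · exact absurd (hξ.lglAngle_lt h2 hk.le) (not_lt.mpr hθ.1.le)
    · exact lt_irrefl _ hθ.1

lemma sin_pos_of_mem_Ioo_lglAngle {j k : ℕ} {θ : ℝ}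
    (hθ : θ ∈ Set.Ioo (lglAngle ξ j) (lglAngle ξ k)) : 0 < Real.sin θ :=
  Real.sin_pos_of_pos_of_lt_pi ((Real.arccos_nonneg _).trans_lt hθ.1)
    (hθ.2.trans_le (Real.arccos_le_pi _))

/-- Consecutive angles are at least `π / (N + 1/2)` apart. -/
lemma pi_div_le_lglAngle_sub (hξ : IsLGLNodes N ξ) {k : ℕ} (hk : k < N) :
    Real.pi / (N + 1 / 2) ≤ lglAngle ξ (k + 1) - lglAngle ξ k := by
  by_contra! hlt
  set a := lglAngle ξ k
  set b := lglAngle ξ (k + 1)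
  set m : ℝ := N + 1 / 2
  have hm : 0 < m := by positivity
  rw [lt_div_iff₀ hm] at hlt
  have hline (x : ℝ) : HasDerivAt (fun x => m * (x - (a + b) / 2)) m x := by
    simpa using ((hasDerivAt_id x).sub_const ((a + b) / 2)).const_mul m
  obtain ⟨x, hx, hx0⟩ := sturm_comparison (u := lglLiouville N) (u' := lglLiouvilleDeriv N)
    (v := fun x => Real.cos (m * (x - (a + b) / 2)))
    (v' := fun x => -Real.sin (m * (x - (a + b) / 2)) * m)
    (q := lglPotential N) (r := fun _ => m ^ 2) (hξ.lglAngle_lt (Nat.lt_succ_self k) hk)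
    (continuous_lglLiouville N).continuousOn (by fun_prop)
    (fun x hx => hasDerivAt_lglLiouville N (sin_pos_of_mem_Ioo_lglAngle hx))
    (fun x hx => hasDerivAt_lglLiouvilleDeriv N (sin_pos_of_mem_Ioo_lglAngle hx))
    (fun x _ => (hline x).cos)
    (fun x _ => by
      exact ((hline x).sin.neg.mul_const m).congr_deriv (by ring))
    (hξ.lglLiouville_lglAngle hk.le) (hξ.lglLiouville_lglAngle hk)
    (fun x hx => hξ.lglLiouville_ne_zero hk hx)
    (fun x _ => sub_le_self _ (by positivity))
  refine (Real.cos_pos_of_mem_Ioo ⟨?_, ?_⟩).ne' hx0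
  · nlinarith [mul_le_mul_of_nonneg_left hx.1 hm.le]
  · nlinarith [mul_le_mul_of_nonneg_left hx.2 hm.le]

/-- The angles form a concave sequence on `[0, π/2]`. -/
lemma lglAngle_sub_antitone (hξ : IsLGLNodes N ξ) {k : ℕ} (hk : k + 2 ≤ N)
    (hhalf : lglAngle ξ (k + 1) < Real.pi / 2) :
    lglAngle ξ (k + 2) - lglAngle ξ (k + 1) ≤ lglAngle ξ (k + 1) - lglAngle ξ k := by
  by_contra! hlt
  obtain ⟨ε, hε, hεlt⟩ := exists_between (lt_min (sub_pos.mpr hlt)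
    (by linarith : 0 < Real.pi - 2 * lglAngle ξ (k + 1)))
  rw [lt_min_iff] at hεlt
  obtain ⟨hε1, hε2⟩ := hεlt
  set c := 2 * lglAngle ξ (k + 1) + ε with hc
  have hmaps : ∀ x ∈ Set.Icc (lglAngle ξ k) (lglAngle ξ (k + 1)),
      c - x ∈ Set.Ioo (lglAngle ξ (k + 1)) (lglAngle ξ (k + 1 + 1)) := fun x hx =>
    ⟨by linarith [hx.2], by
      change c - x < lglAngle ξ (k + 2)
      linarith [hx.1]⟩
  have hrefl (x : ℝ) : HasDerivAt (fun x => c - x) (-1) x := by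
    simpa using (hasDerivAt_id x).const_sub c
  obtain ⟨x, hx, hx0⟩ := sturm_comparison (u := lglLiouville N) (u' := lglLiouvilleDeriv N)
    (v := fun x => lglLiouville N (c - x)) (v' := fun x => -lglLiouvilleDeriv N (c - x))
    (q := lglPotential N) (r := fun x => lglPotential N (c - x))
    (hξ.lglAngle_lt (Nat.lt_succ_self k) (by omega))
    (continuous_lglLiouville N).continuousOn
    ((continuous_lglLiouville N).comp (by fun_prop)).continuousOn
    (fun x hx => hasDerivAt_lglLiouville N (sin_pos_of_mem_Ioo_lglAngle hx))
    (fun x hx => hasDerivAt_lglLiouvilleDeriv N (sin_pos_of_mem_Ioo_lglAngle hx))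
    (fun x hx => by
      have := (hasDerivAt_lglLiouville N
        (sin_pos_of_mem_Ioo_lglAngle (hmaps x (Set.Ioo_subset_Icc_self hx)))).comp x (hrefl x)
      simpa [Function.comp_def] using this)
    (fun x hx => by
      exact ((hasDerivAt_lglLiouvilleDeriv N
        (sin_pos_of_mem_Ioo_lglAngle (hmaps x (Set.Ioo_subset_Icc_self hx)))).comp x
          (hrefl x)).neg.congr_deriv (by ring))
    (hξ.lglLiouville_lglAngle (by omega)) (hξ.lglLiouville_lglAngle (by omega))
    (fun x hx => hξ.lglLiouville_ne_zero (by omega) hx)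
    (fun x hx => by
      have hs := sin_pos_of_mem_Ioo_lglAngle hx
      have hle : Real.sin x ≤ Real.sin (c - x) := by
        have hcos : 0 ≤ Real.cos ((c - x + x) / 2) :=
          Real.cos_nonneg_of_neg_pi_div_two_le_of_le
            (by linarith [Real.arccos_nonneg (-ξ (k + 1)),
                show lglAngle ξ (k + 1) = Real.arccos (-ξ (k + 1)) from rfl, Real.pi_pos])
            (by linarith)
        have hsin : 0 ≤ Real.sin ((c - x - x) / 2) :=
          Real.sin_nonneg_of_nonneg_of_le_pi (by linarith [hx.2])
            (by linarith [hx.1, Real.arccos_nonneg (-ξ k), Real.pi_pos,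
                show lglAngle ξ k = Real.arccos (-ξ k) from rfl])
        have := Real.sin_sub_sin (c - x) x
        nlinarith [mul_nonneg hsin hcos]
      unfold lglPotential
      gcongr)
  exact hξ.lglLiouville_ne_zero (by omega) (hmaps x hx) hx0

lemma lglAngle_lt_pi_div_two (hξ : IsLGLNodes N ξ) {k : ℕ} (hk : 2 * k < N) :
    lglAngle ξ k < Real.pi / 2 := by
  have h1 := hξ.lglAngle_lt (show k < N - k by omega) (Nat.sub_le _ _)
  rw [hξ.lglAngle_symm (by omega)] at h1
  linarith

lemma mul_lglAngle_succ_le (hξ : IsLGLNodes N ξ) {k : ℕ} (hk : 2 * k < N) :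
    k * lglAngle ξ (k + 1) ≤ (k + 1) * lglAngle ξ k := by
  induction k with
  | zero => simp [hξ.lglAngle_zero]
  | succ k ih =>
    have h1 := ih (by omega)
    have h2 := hξ.lglAngle_sub_antitone (k := k) (by omega) (hξ.lglAngle_lt_pi_div_two hk)
    have h3 := mul_le_mul_of_nonneg_left h2 (show (0 : ℝ) ≤ k + 1 by positivity)
    push_cast
    rw [show k + 1 + 1 = k + 2 from rfl]
    linarith

lemma mul_lglAngle_le (hξ : IsLGLNodes N ξ) {j k : ℕ} (hj : 1 ≤ j) (hjk : j ≤ k)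
    (hk : 2 * k < N + 2) :
    j * lglAngle ξ k ≤ k * lglAngle ξ j := by
  induction k, hjk using Nat.le_induction with
  | base => exact le_refl _
  | succ k hjk ih =>
    have h1 := ih (by omega)
    have h2 := hξ.mul_lglAngle_succ_le (k := k) (by omega)
    have hk0 : (0 : ℝ) < k := by exact_mod_cast (by omega : 0 < k)
    push_cast
    have h3 := mul_le_mul_of_nonneg_left h1 (show (0 : ℝ) ≤ k + 1 by positivity)
    have h4 := mul_le_mul_of_nonneg_left h2 (show (0 : ℝ) ≤ j by positivity)
    refine le_of_mul_le_mul_left ?_ hk0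
    linarith

/-- Lower bound for the angles in the first half. -/
lemma pi_mul_div_le_lglAngle (hξ : IsLGLNodes N ξ) {k : ℕ} (hk1 : 1 ≤ k) (hk : 2 * k ≤ N) :
    Real.pi * k / N ≤ lglAngle ξ k := by
  have hN : (0 : ℝ) < N := by exact_mod_cast (by omega : 0 < N)
  rw [div_le_iff₀ hN]
  obtain ⟨m, hm | hm⟩ := N.even_or_odd'
  · have h1 := hξ.mul_lglAngle_le hk1 (show k ≤ m by omega) (by omega)
    have h2 := hξ.lglAngle_symm (k := m) (by omega)
    rw [show N - m = m by omega] at h2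
    have h3 : (N : ℝ) = 2 * m := by exact_mod_cast hm
    rw [h3]
    rw [show lglAngle ξ m = Real.pi / 2 by linarith] at h1
    linarith
  · have h1 := hξ.mul_lglAngle_le hk1 (show k ≤ m by omega) (by omega)
    have h1' := hξ.mul_lglAngle_le hk1 (show k ≤ m + 1 by omega) (by omega)
    have h2 := hξ.lglAngle_symm (k := m) (by omega)
    rw [show N - m = m + 1 by omega] at h2
    have h3 : (N : ℝ) = 2 * m + 1 := by exact_mod_cast hm
    rw [h3]
    rw [h2] at h1'
    push_cast at h1'
    linarith

lemma mul_pi_div_le_lglAngle_sub (hξ : IsLGLNodes N ξ) {j k : ℕ} (hjk : j ≤ k) (hk : k ≤ N) :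
    ((k : ℝ) - j) * (Real.pi / (N + 1 / 2)) ≤ lglAngle ξ k - lglAngle ξ j := by
  induction k, hjk using Nat.le_induction with
  | base => simp
  | succ k hjk ih =>
    have h1 := ih (by omega)
    have h2 := hξ.pi_div_le_lglAngle_sub (k := k) (by omega)
    push_cast
    linarith

/-- Upper bound for the angles in the first half. -/
lemma lglAngle_le (hξ : IsLGLNodes N ξ) {k : ℕ} (hk : 2 * k ≤ N) :
    lglAngle ξ k ≤ Real.pi * (2 * k + 1) / (2 * N + 1) := by
  have h1 := hξ.mul_pi_div_le_lglAngle_sub (show k ≤ N - k by omega) (Nat.sub_le _ _)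
  rw [hξ.lglAngle_symm (by omega), Nat.cast_sub (by omega)] at h1
  have hN : (0 : ℝ) < 2 * N + 1 := by positivity
  have hd : Real.pi / (N + 1 / 2) * (2 * N + 1) = 2 * Real.pi := by field_simp
  rw [le_div_iff₀ hN]
  have h2 := mul_le_mul_of_nonneg_right h1 hN.le
  rw [mul_assoc, hd] at h2
  linarith [Real.pi_pos]

end IsLGLNodes

open Real in
/-- Sharp sine bounds for the LGL interval lengths: for `N ≥ 5` and
`1 ≤ k ≤ ⌊(N-1)/2⌋ - 1`,
`2 sin(π/2·(4kN+k+3N+1)/(N(2N+1))) sin(π/2·(N+k+1)/(N(2N+1))) ≤ |Δ_k^N|`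
and
`|Δ_k^N| ≤ 2 sin(π/2·(4kN+3N+k)/(N(2N+1))) sin(π/2·(3N-k)/(N(2N+1)))`. -/
theorem lgl_interval_length_bounds (N : ℕ) (hN : 5 ≤ N) (ξ : ℕ → ℝ)
    (hξ : IsLGLNodes N ξ) (k : ℕ) (hk1 : 1 ≤ k) (hk2 : k ≤ (N - 1) / 2 - 1) :
    2 * Real.sin (π / 2 * ((4 * (k : ℝ) * N + k + 3 * N + 1) / (N * (2 * N + 1)))) *
        Real.sin (π / 2 * (((N : ℝ) + k + 1) / (N * (2 * N + 1)))) ≤ ξ (k + 1) - ξ k ∧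
    ξ (k + 1) - ξ k ≤
      2 * Real.sin (π / 2 * ((4 * (k : ℝ) * N + 3 * N + k) / (N * (2 * N + 1)))) *
        Real.sin (π / 2 * ((3 * (N : ℝ) - k) / (N * (2 * N + 1)))) := by
  have hkN : 2 * (k + 1) ≤ N := by omega
  have hN0 : (0 : ℝ) < N := by exact_mod_cast (by omega : 0 < N)
  have hl := hξ.pi_mul_div_le_lglAngle hk1 (by omega)
  have hl' := hξ.pi_mul_div_le_lglAngle (k := k + 1) (by omega) hkN
  have hu := hξ.lglAngle_le (k := k) (by omega)
  have hu' := hξ.lglAngle_le hkN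
  have hdiff : ξ (k + 1) - ξ k = cos (lglAngle ξ k) - cos (lglAngle ξ (k + 1)) := by
    rw [hξ.cos_lglAngle (by omega), hξ.cos_lglAngle (by omega)]
    ring
  have hkR : 2 * ((k : ℝ) + 1) ≤ N := by exact_mod_cast hkN
  push_cast at hl' hu'
  have hprod (a b : ℝ) : 2 * sin a * sin b = cos (a - b) - cos (a + b) := by
    rw [cos_sub, cos_add]; ring
  have hcos {a b : ℝ} (ha : 0 ≤ a) (hb : b ≤ π) (hab : a ≤ b) : cos b ≤ cos a :=
    cos_le_cos_of_nonneg_of_le_pi ha hb hab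
  have hpi {a b : ℝ} (hb : 0 < b) (h : a ≤ b) : π * a / b ≤ π := by
    rw [div_le_iff₀ hb]
    exact mul_le_mul_of_nonneg_left h pi_pos.le
  rw [hdiff, hprod, hprod]
  constructor
  · rw [show π / 2 * ((4 * (k : ℝ) * N + k + 3 * N + 1) / (N * (2 * N + 1))) -
        π / 2 * (((N : ℝ) + k + 1) / (N * (2 * N + 1))) = π * (2 * k + 1) / (2 * N + 1) by
        field_simp; ring,
      show π / 2 * ((4 * (k : ℝ) * N + k + 3 * N + 1) / (N * (2 * N + 1))) +
        π / 2 * (((N : ℝ) + k + 1) / (N * (2 * N + 1))) = π * (k + 1) / N by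
        field_simp; ring]
    exact sub_le_sub (hcos (arccos_nonneg _) (hpi (by positivity) (by linarith)) hu)
      (hcos (by positivity) (arccos_le_pi _) hl')
  · rw [show π / 2 * ((4 * (k : ℝ) * N + 3 * N + k) / (N * (2 * N + 1))) -
        π / 2 * ((3 * (N : ℝ) - k) / (N * (2 * N + 1))) = π * k / N by
        field_simp; ring,
      show π / 2 * ((4 * (k : ℝ) * N + 3 * N + k) / (N * (2 * N + 1))) +
        π / 2 * ((3 * (N : ℝ) - k) / (N * (2 * N + 1))) =
          π * (2 * (k + 1) + 1) / (2 * N + 1) by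
        field_simp; ring]
    exact sub_le_sub (hcos (by positivity) (arccos_le_pi _) hl)
      (hcos (arccos_nonneg _) (hpi (by positivity) (by linarith)) hu')
end

section
/- For every odd integer N ≥ 3, the central LGL interval satisfies 2/(2N+1) ≤ |Δ_{(N−1)/2}^N| ≤ (4N−2)/N². -/
open Polynomial in
/-- Rodrigues-type recursion: the iterated derivatives of `(X² - 1)^N` satisfy a
second-order linear differential equation. -/
theorem iterate_derivative_sq_sub_one_pow_ode (N j : ℕ) :
    ((X : ℝ[X]) ^ 2 - 1) * derivative^[j + 2] ((X ^ 2 - 1) ^ N) +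
      C (2 * ((j : ℝ) + 1) - 2 * N) * X * derivative^[j + 1] ((X ^ 2 - 1) ^ N) +
      C (((j : ℝ) + 1) * (j - 2 * N)) * derivative^[j] ((X ^ 2 - 1) ^ N) = 0 := by
  set v : ℝ[X] := (X ^ 2 - 1) ^ N with hv
  have first_order : ((X : ℝ[X]) ^ 2 - 1) * derivative v = C (2 * (N : ℝ)) * X * v := by
    rcases N with _ | n
    · simp [hv]
    · rw [hv, derivative_pow]
      simp only [derivative_sub, derivative_X_pow, derivative_one, Nat.add_sub_cancel]
      simp only [C_mul, map_natCast, map_ofNat]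
      push_cast
      ring
  induction j with
  | zero =>
    have h := congrArg derivative first_order
    simp only [derivative_mul, derivative_sub, derivative_X_pow, derivative_one, derivative_C,
      derivative_X] at h
    simp only [Function.iterate_succ_apply', Function.iterate_zero, id]
    simp only [C_mul, C_sub, C_add, map_natCast, map_ofNat, map_one, CharP.cast_eq_zero,
      map_zero] at h ⊢
    push_cast at h ⊢
    linear_combination h
  | succ j ih =>
    have h := congrArg derivative ih
    simp only [derivative_mul, derivative_sub, derivative_X_pow, derivative_one, derivative_C,
      derivative_X, derivative_add, derivative_zero, ← Function.iterate_succ_apply'] at h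
    simp only [C_mul, C_sub, C_add, map_natCast, map_ofNat, map_one] at h ⊢
    push_cast at h ⊢
    linear_combination h

open Polynomial in
/-- Legendre's differential equation. -/
theorem legendrePoly_ode (N : ℕ) :
    (1 - (X : ℝ[X]) ^ 2) * derivative (derivative (legendrePoly N)) -
      2 * X * derivative (legendrePoly N) + C ((N : ℝ) * (N + 1)) * legendrePoly N = 0 := by
  have h := iterate_derivative_sq_sub_one_pow_ode N N
  simp only [legendrePoly, derivative_C_mul, ← Function.iterate_succ_apply' derivative]
  simp only [C_mul, C_sub, C_add, map_natCast, map_ofNat, map_one] at h ⊢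
  linear_combination (-C (1 / (2 ^ N * N.factorial : ℝ))) * h

open Polynomial in
theorem iterate_derivative_comp_neg_X_of_even {p : ℝ[X]} (hp : p.comp (-X) = p) (k : ℕ) :
    (derivative^[k] p).comp (-X) = (-1) ^ k * derivative^[k] p := by
  induction k with
  | zero => simpa using hp
  | succ k ih =>
    have h := congrArg derivative ih
    have hc : derivative ((-1 : ℝ[X]) ^ k) = 0 := by
      rw [show (-1 : ℝ[X]) ^ k = C ((-1) ^ k) by simp, derivative_C]
    rw [derivative_comp, derivative_mul, hc] at h
    simp only [derivative_neg, derivative_X, ← Function.iterate_succ_apply' derivative] at h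
    rw [pow_succ]
    linear_combination (-1 : ℝ[X]) * h

open Polynomial in
theorem legendrePoly_comp_neg_X (N : ℕ) :
    (legendrePoly N).comp (-X) = (-1) ^ N * legendrePoly N := by
  have h := iterate_derivative_comp_neg_X_of_even (p := (X ^ 2 - 1) ^ N) (by simp) N
  simp only [legendrePoly, mul_comp, C_comp, h]
  ring

open Polynomial in
theorem legendrePoly_eval_neg {N : ℕ} (hodd : Odd N) (x : ℝ) :
    (legendrePoly N).eval (-x) = -(legendrePoly N).eval x := by
  have h := congrArg (eval x) (legendrePoly_comp_neg_X N)
  simpa [eval_comp, hodd.neg_one_pow] using h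

open Polynomial in
theorem derivative_legendrePoly_eval_neg {N : ℕ} (hodd : Odd N) (x : ℝ) :
    (derivative (legendrePoly N)).eval (-x) = (derivative (legendrePoly N)).eval x := by
  have h := congrArg (fun p => eval x (derivative p)) (legendrePoly_comp_neg_X N)
  simpa [eval_comp, hodd.neg_one_pow, derivative_comp] using h

theorem lglPoly_eval_neg {N : ℕ} (hodd : Odd N) (x : ℝ) :
    (lglPoly N).eval (-x) = (lglPoly N).eval x := by
  simp [lglPoly, derivative_legendrePoly_eval_neg hodd]

/-- The Legendre-Gauss-Lobatto nodes of odd order are symmetric about the origin. -/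
theorem IsLGLNodes.reflect {N : ℕ} (hodd : Odd N) {ξ : ℕ → ℝ} (hξ : IsLGLNodes N ξ)
    {k : ℕ} (hk : k ≤ N) : ξ (N - k) = -ξ k := by
  obtain ⟨hmono, -, -, hzero, hsurj⟩ := hξ
  let f : Fin (N + 1) → ℝ := fun i => ξ (N - i)
  let g : Fin (N + 1) → ℝ := fun i => -ξ i
  have hf : StrictMono (fun i : Fin (N + 1) => -f i) := by
    intro i j hij
    have : ξ (N - j) < ξ (N - i) :=
      hmono (Set.mem_Iic.2 (by omega)) (Set.mem_Iic.2 (by omega)) (by omega)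
    exact neg_lt_neg this
  have hg : StrictMono (fun i : Fin (N + 1) => -g i) := by
    intro i j hij
    have : ξ i < ξ j := hmono (Set.mem_Iic.2 (by omega)) (Set.mem_Iic.2 (by omega)) hij
    simpa [g] using this
  have hrange : Set.range (fun i : Fin (N + 1) => -f i) =
      Set.range (fun i : Fin (N + 1) => -g i) := by
    have key (x : ℝ) : (∃ k ≤ N, ξ k = x) ↔ (lglPoly N).eval x = 0 :=
      ⟨by rintro ⟨k, hk, rfl⟩; exact hzero k hk, hsurj x⟩
    ext x
    constructor
    · rintro ⟨i, rfl⟩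
      obtain ⟨j, hj, hjx⟩ := (key (-f i)).2 (by
        rw [lglPoly_eval_neg hodd]; exact hzero _ (by omega))
      exact ⟨⟨j, by omega⟩, by simpa [g] using hjx⟩
    · rintro ⟨i, rfl⟩
      obtain ⟨j, hj, hjx⟩ := (key (g i)).2 (by
        rw [lglPoly_eval_neg hodd]; exact hzero _ (by omega))
      refine ⟨⟨N - j, by omega⟩, ?_⟩
      have : N - (N - j) = j := by omega
      simp only [f, this, hjx]
  have h := congrFun ((hf.range_inj hg).1 hrange) ⟨k, by omega⟩
  simpa [f, g, neg_eq_iff_eq_neg] using h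

/-- Sturm comparison with `cos (c x)`: if `u'' ≤ -c² u` on `[0, π / (2c)]` with `u' (0) = 0`, then
`u` cannot be positive on this whole interval. -/
theorem sturm_upper {u u' u'' : ℝ → ℝ} {c : ℝ} (hc : 0 < c)
    (hu : ∀ x, HasDerivAt u (u' x) x) (hu' : ∀ x, HasDerivAt u' (u'' x) x) (h0 : u' 0 = 0)
    (hle : ∀ x ∈ Set.Icc 0 (Real.pi / (2 * c)), u'' x ≤ -c ^ 2 * u x) :
    u (Real.pi / (2 * c)) ≤ 0 := by
  set b := Real.pi / (2 * c) with hb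
  have hb0 : 0 ≤ b := by positivity
  have hcb : c * b = Real.pi / 2 := by rw [hb]; field_simp
  have hlin (x : ℝ) : HasDerivAt (fun x => c * x) c x := by
    simpa using (hasDerivAt_id x).const_mul c
  have hW (x : ℝ) := ((hu' x).mul (hlin x).cos).add ((hu x).mul ((hlin x).sin.const_mul c))
  have hanti : AntitoneOn _ (Set.Icc 0 b) := antitoneOn_of_hasDerivWithinAt_nonpos
    (convex_Icc 0 b) (fun x _ => (hW x).continuousAt.continuousWithinAt)
    (fun x _ => (hW x).hasDerivWithinAt) (fun x hx => by
      rw [interior_Icc] at hx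
      have hcos : 0 ≤ Real.cos (c * x) := Real.cos_nonneg_of_neg_pi_div_two_le_of_le
        (by nlinarith [Real.pi_pos, hx.1]) (by nlinarith [hx.2])
      nlinarith [mul_nonneg hcos (sub_nonneg.2 (hle x ⟨hx.1.le, hx.2.le⟩))])
  have h := hanti (Set.left_mem_Icc.2 hb0) (Set.right_mem_Icc.2 hb0) hb0
  simp only [Pi.add_apply, Pi.mul_apply, hcb, Real.cos_pi_div_two, Real.sin_pi_div_two, h0,
    mul_zero, Real.sin_zero] at h
  nlinarith

/-- Sturm comparison with `cos (c x)`: if `u'' ≥ -c² u` on `[0, a]` with `c a < π / 2` and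
`u' (0) = 0`, then `u' (a)` is nonnegative as soon as `u (a) = 0`. -/
theorem sturm_lower {u u' u'' : ℝ → ℝ} {a c : ℝ} (ha : 0 ≤ a) (hc : 0 < c)
    (hac : c * a < Real.pi / 2)
    (hu : ∀ x, HasDerivAt u (u' x) x) (hu' : ∀ x, HasDerivAt u' (u'' x) x) (h0 : u' 0 = 0)
    (hle : ∀ x ∈ Set.Icc 0 a, -c ^ 2 * u x ≤ u'' x) (hua : u a = 0) :
    0 ≤ u' a := by
  have hlin (x : ℝ) : HasDerivAt (fun x => c * x) c x := by
    simpa using (hasDerivAt_id x).const_mul c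
  have hW (x : ℝ) := ((hu' x).mul (hlin x).cos).add ((hu x).mul ((hlin x).sin.const_mul c))
  have hmono : MonotoneOn _ (Set.Icc 0 a) := monotoneOn_of_hasDerivWithinAt_nonneg
    (convex_Icc 0 a) (fun x _ => (hW x).continuousAt.continuousWithinAt)
    (fun x _ => (hW x).hasDerivWithinAt) (fun x hx => by
      rw [interior_Icc] at hx
      have hcos : 0 ≤ Real.cos (c * x) := Real.cos_nonneg_of_neg_pi_div_two_le_of_le
        (by nlinarith [Real.pi_pos, hx.1]) (by nlinarith [hx.2])
      nlinarith [mul_nonneg hcos (sub_nonneg.2 (hle x ⟨hx.1.le, hx.2.le⟩))])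
  have h := hmono (Set.left_mem_Icc.2 ha) (Set.right_mem_Icc.2 ha) ha
  simp only [Pi.add_apply, Pi.mul_apply, h0, hua, mul_zero, Real.sin_zero, zero_mul,
    add_zero] at h
  have hcos : 0 < Real.cos (c * a) := Real.cos_pos_of_mem_Ioo
    ⟨by nlinarith [Real.pi_pos], hac⟩
  exact nonneg_of_mul_nonneg_left h hcos

open Polynomial in
/-- Bounds on the first positive critical point of an odd solution of Legendre's equation. -/
theorem legendre_ode_first_critical_point_bounds {n a : ℝ} (hn : 3 ≤ n) {p : ℝ[X]}
    (hode : (1 - (X : ℝ[X]) ^ 2) * derivative (derivative p) - 2 * X * derivative p +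
      C (n * (n + 1)) * p = 0)
    (hp0 : p.eval 0 = 0) (ha0 : 0 < a) (ha1 : a < 1)
    (hpos : ∀ x ∈ Set.Ico 0 a, 0 < (derivative p).eval x) (hpa : (derivative p).eval a = 0) :
    1 / (2 * n + 1) ≤ a ∧ a ≤ (2 * n - 1) / n ^ 2 := by
  let u : ℝ → ℝ := fun x => ((1 - X ^ 2) * derivative p).eval x
  let u' : ℝ → ℝ := fun x => (-C (n * (n + 1)) * p).eval x
  let u'' : ℝ → ℝ := fun x => (-C (n * (n + 1)) * derivative p).eval x
  have hu (x : ℝ) : HasDerivAt u (u' x) x := by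
    have h := ((1 - X ^ 2) * derivative p).hasDerivAt x
    have he : derivative ((1 - X ^ 2) * derivative p) = -C (n * (n + 1)) * p := by
      simp only [derivative_mul, derivative_sub, derivative_one, derivative_X_pow]
      simp only [Nat.cast_ofNat, map_ofNat]
      linear_combination hode
    rwa [he] at h
  have hu' (x : ℝ) : HasDerivAt u' (u'' x) x := by
    have h := (-C (n * (n + 1)) * p).hasDerivAt x
    have he : derivative (-C (n * (n + 1)) * p) = -C (n * (n + 1)) * derivative p := by
      rw [← C_neg, derivative_C_mul]
    rwa [he] at h
  have h0 : u' 0 = 0 := by simp [u', hp0]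
  have hnonneg : ∀ x ∈ Set.Icc 0 a, 0 ≤ (derivative p).eval x := by
    intro x hx
    rcases hx.2.lt_or_eq with h | rfl
    · exact (hpos x ⟨hx.1, h⟩).le
    · exact hpa.ge
  constructor
  · by_contra! hlt
    rw [lt_div_iff₀ (by linarith)] at hlt
    have hmain : 0 ≤ u' a := by
      refine sturm_lower (c := 2 * n + 1) ha0.le (by linarith)
        (by linarith [Real.pi_gt_three]) hu hu' h0 (fun x hx => ?_) (by simp [u, hpa])
      have hd := hnonneg x hx
      have hx2 : x ^ 2 ≤ 1 / 2 := by nlinarith [hx.1, hx.2]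
      simp only [u, u'', eval_mul, eval_sub, eval_one, eval_pow, eval_X, eval_neg, eval_C]
      have : n * (n + 1) ≤ (2 * n + 1) ^ 2 * (1 - x ^ 2) := by nlinarith
      nlinarith
    have hmono : StrictMonoOn (fun x => p.eval x) (Set.Icc 0 a) :=
      strictMonoOn_of_deriv_pos (convex_Icc 0 a) p.continuous.continuousOn (fun x hx => by
        rw [interior_Icc] at hx
        rw [Polynomial.deriv]
        exact hpos x ⟨hx.1.le, hx.2⟩)
    have hpa_pos : p.eval 0 < p.eval a :=
      hmono (Set.left_mem_Icc.2 ha0.le) (Set.right_mem_Icc.2 ha0.le) ha0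
    simp only [u', eval_mul, eval_neg, eval_C] at hmain
    nlinarith [mul_pos (show 0 < n * (n + 1) by positivity) (hp0 ▸ hpa_pos)]
  · by_contra! hlt
    have hb : Real.pi / (2 * n) ≤ (2 * n - 1) / n ^ 2 := by
      rw [div_le_div_iff₀ (by linarith) (by positivity)]
      have : Real.pi * n ≤ 4 * n - 2 := by nlinarith [Real.pi_lt_d2]
      nlinarith
    have hba : Real.pi / (2 * n) < a := hb.trans_lt hlt
    have hb0 : 0 ≤ Real.pi / (2 * n) := by positivity
    have hmain := sturm_upper (c := n) (by linarith) hu hu' h0 (fun x hx => by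
      have hd := (hpos x ⟨hx.1, hx.2.trans_lt hba⟩).le
      simp only [u, u'', eval_mul, eval_sub, eval_one, eval_pow, eval_X, eval_neg, eval_C]
      have : n ^ 2 * (1 - x ^ 2) ≤ n * (n + 1) := by nlinarith [sq_nonneg (n * x)]
      nlinarith)
    have hd := hpos _ ⟨hb0, hba⟩
    set b := Real.pi / (2 * n)
    simp only [u, eval_mul, eval_sub, eval_one, eval_pow, eval_X] at hmain
    have : 0 < 1 - b ^ 2 := by nlinarith
    nlinarith [mul_pos this hd]

/-- Bounds on the central LGL interval for odd order: for odd `N ≥ 3`,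
`2/(2N+1) ≤ |Δ_{(N-1)/2}^N| ≤ (4N-2)/N²`. -/
theorem lgl_central_interval_bounds_odd (N : ℕ) (hN : 3 ≤ N) (hodd : Odd N)
    (ξ : ℕ → ℝ) (hξ : IsLGLNodes N ξ) :
    2 / (2 * (N : ℝ) + 1) ≤ ξ ((N - 1) / 2 + 1) - ξ ((N - 1) / 2) ∧
    ξ ((N - 1) / 2 + 1) - ξ ((N - 1) / 2) ≤ (4 * (N : ℝ) - 2) / (N : ℝ) ^ 2 := by
  set m := (N - 1) / 2 with hm
  have hNm : N = 2 * m + 1 := by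
    obtain ⟨k, rfl⟩ := hodd
    omega
  have hsymm : ξ (m + 1) = -ξ m := by
    have h := hξ.reflect hodd (k := m) (by omega)
    rwa [show N - m = m + 1 by omega] at h
  obtain ⟨hmono, -, hξN, hzero, hsurj⟩ := hξ
  have hlt : ξ m < ξ (m + 1) :=
    hmono (Set.mem_Iic.2 (by omega)) (Set.mem_Iic.2 (by omega)) (by omega)
  have ha1 : ξ (m + 1) < 1 :=
    hξN ▸ hmono (Set.mem_Iic.2 (by omega)) (Set.mem_Iic.2 le_rfl) (by omega)
  set a := ξ (m + 1) with ha
  have ha0 : 0 < a := by linarith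
  set L := legendrePoly N with hL
  have hLa : L.derivative.eval a = 0 := by
    have h := hzero (m + 1) (by omega)
    simp only [lglPoly, Polynomial.eval_mul, Polynomial.eval_sub, Polynomial.eval_one,
      Polynomial.eval_pow, Polynomial.eval_X] at h
    exact (mul_eq_zero.1 h).resolve_left (by nlinarith)
  have hne : ∀ x ∈ Set.Ico 0 a, L.derivative.eval x ≠ 0 := by
    intro x hx h
    obtain ⟨k, hk, rfl⟩ := hsurj x (by simp [lglPoly, ← hL, h])
    have h1 : m < k := (hmono.lt_iff_lt (Set.mem_Iic.2 (by omega)) (Set.mem_Iic.2 hk)).1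
      (by linarith [hx.1])
    have h2 : k < m + 1 := (hmono.lt_iff_lt (Set.mem_Iic.2 hk) (Set.mem_Iic.2 (by omega))).1 hx.2
    omega
  have hL0 : L.eval 0 = 0 := by
    have h := legendrePoly_eval_neg hodd 0
    rw [neg_zero] at h
    linarith
  set c := L.derivative.eval 0 with hc
  have hpos : ∀ x ∈ Set.Ico 0 a, 0 < (Polynomial.derivative (Polynomial.C c * L)).eval x := by
    intro x hx
    rw [Polynomial.derivative_C_mul, Polynomial.eval_mul, Polynomial.eval_C]
    by_contra! hle
    have hc0 : 0 < c * c := mul_self_pos.2 (hne 0 ⟨le_rfl, ha0⟩)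
    obtain ⟨y, hy, hy0⟩ := intermediate_value_Icc' (f := fun x => c * L.derivative.eval x) hx.1
      (by fun_prop) (show (0 : ℝ) ∈ Set.Icc _ _ from ⟨hle, hc0.le⟩)
    rcases mul_eq_zero.1 hy0 with h | h
    · simp [h] at hc0
    · exact hne y ⟨hy.1, hy.2.trans_lt hx.2⟩ h
  have hbounds := legendre_ode_first_critical_point_bounds (n := N) (a := a)
    (p := Polynomial.C c * L) (by exact_mod_cast hN) (by
      simp only [Polynomial.derivative_C_mul]
      linear_combination Polynomial.C c * legendrePoly_ode N)
    (by simp [hL0]) ha0 ha1 hpos (by simp [hLa])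
  have hlen : a - ξ m = 2 * a := by linarith
  rw [hlen]
  constructor
  · calc 2 / (2 * (N : ℝ) + 1) = 2 * (1 / (2 * (N : ℝ) + 1)) := by ring
      _ ≤ 2 * a := by linarith [hbounds.1]
  · calc 2 * a ≤ 2 * ((2 * (N : ℝ) - 1) / (N : ℝ) ^ 2) := by linarith [hbounds.2]
      _ = (4 * (N : ℝ) - 2) / (N : ℝ) ^ 2 := by ring
end

section
/- Local uniform equivalence of CGL grids of comparable order: for every constant c with 0 < c ≤ 1, there exist constants A and B with 0 < A ≤ B, depending only on c, such that for all integers M, N with 1 ≤ M, c·N ≤ M ≤ N, and all integers k, ℓ with 0 ≤ k ≤ N−1 and 0 ≤ ℓ ≤ M−1, if Λ_k^N ∩ Λ_ℓ^M ≠ ∅ then A ≤ |Λ_k^N|/|Λ_ℓ^M| ≤ B. -/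
/-- The Chebyshev-Gauss-Lobatto node `ζ_k^N = -cos(kπ/N)`. -/
noncomputable def cgl (N k : ℕ) : ℝ := -Real.cos (k * Real.pi / N)

open Real in
theorem cgl_succ_sub (N k : ℕ) :
    cgl N (k + 1) - cgl N k = 2 * sin ((2 * k + 1) * (π / (2 * N))) * sin (π / (2 * N)) := by
  have h := cos_sub_cos (k * π / N) ((k + 1 : ℕ) * π / N)
  have h₁ : (k * π / N + (k + 1 : ℕ) * π / N) / 2 = (2 * k + 1) * (π / (2 * N)) := by
    push_cast
    ring
  have h₂ : (k * π / N - (k + 1 : ℕ) * π / N) / 2 = -(π / (2 * N)) := by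
    push_cast
    ring
  rw [h₁, h₂, sin_neg] at h
  unfold cgl
  linarith

open Real in
theorem sin_le_sin_of_mem_Icc {g y : ℝ} (hg : 0 ≤ g) (hy : y ∈ Set.Icc g (π - g)) :
    sin g ≤ sin y := by
  obtain ⟨h₁, h₂⟩ := hy
  rcases le_total y (π / 2) with h | h
  · exact sin_le_sin_of_le_of_le_pi_div_two (by linarith) h h₁
  · rw [← sin_pi_sub y]
    exact sin_le_sin_of_le_of_le_pi_div_two (by linarith) (by linarith) (by linarith)

open Real in
theorem half_le_sin {g : ℝ} (hg : 0 ≤ g) (hg' : g ≤ π / 2) : g / 2 ≤ sin g := by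
  have h := mul_le_sin hg hg'
  have h₁ : 1 / 2 ≤ 2 / π := by
    rw [div_le_div_iff₀ (by norm_num) pi_pos]
    linarith [pi_le_four]
  nlinarith

open Real in
theorem sin_le_mul_sin_of_abs_sub_le {g r x y : ℝ} (hg : 0 ≤ g) (hr : 0 ≤ r)
    (hy : y ∈ Set.Icc g (π - g)) (hxy : |x - y| ≤ r * g) :
    sin x ≤ (1 + 2 * r) * sin y := by
  have h₁ : |sin x - sin y| ≤ |x - y| := by
    simpa [Real.dist_eq] using lipschitzWith_sin.dist_le_mul x y
  have h₂ := sin_le_sin_of_mem_Icc hg hy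
  have h₃ := half_le_sin hg (by linarith [hy.1, hy.2])
  have h₄ : r * g ≤ r * (2 * sin y) := mul_le_mul_of_nonneg_left (by linarith) hr
  linarith [le_abs_self (sin x - sin y)]

open Real in
theorem midpoint_mem_Icc {N k : ℕ} (hk : k < N) :
    (2 * k + 1) * (π / (2 * N)) ∈ Set.Icc (π / (2 * N)) (π - π / (2 * N)) := by
  have hN : (0 : ℝ) < N := by exact_mod_cast (by omega : 0 < N)
  have hp : 0 < π / (2 * N) := by positivity
  have hkN : (k : ℝ) + 1 ≤ N := by exact_mod_cast hk
  have hpi : π = 2 * N * (π / (2 * N)) := by field_simp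
  have hk0 : (0 : ℝ) ≤ k := k.cast_nonneg
  constructor <;> nlinarith

open Real in
theorem angle_le_of_cgl_le {M N i j : ℕ} (hM : 0 < M) (hN : 0 < N) (hi : i ≤ N) (hj : j ≤ M)
    (h : cgl N i ≤ cgl M j) : 2 * i * (π / (2 * N)) ≤ 2 * j * (π / (2 * M)) := by
  have mem : ∀ {n m : ℕ}, 0 < n → m ≤ n → m * π / n ∈ Set.Icc 0 π := by
    intro n m hn hm
    have hn' : (0 : ℝ) < n := by exact_mod_cast hn
    have hm' : (m : ℝ) ≤ n := by exact_mod_cast hm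
    refine ⟨by positivity, ?_⟩
    rw [div_le_iff₀ hn']
    nlinarith [pi_pos]
  have h' := (strictAntiOn_cos.le_iff_ge (mem hM hj) (mem hN hi)).1 (neg_le_neg_iff.1 h)
  have eq : ∀ a b : ℝ, 2 * a * (π / (2 * b)) = a * π / b := fun a b => by ring
  rw [eq, eq]
  exact h'

/-- Local uniform equivalence of CGL grids of comparable order: for `0 < c ≤ 1`
there are `0 < A ≤ B` depending only on `c` such that whenever `1 ≤ M`,
`c·N ≤ M ≤ N`, `0 ≤ k ≤ N-1`, `0 ≤ ℓ ≤ M-1` and `Λ_k^N ∩ Λ_ℓ^M ≠ ∅`, one has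
`A ≤ |Λ_k^N|/|Λ_ℓ^M| ≤ B`. -/
theorem cgl_local_uniform_equivalence (c : ℝ) (hc0 : 0 < c) (hc1 : c ≤ 1) :
    ∃ A B : ℝ, 0 < A ∧ A ≤ B ∧
      ∀ M N : ℕ, 1 ≤ M → c * (N : ℝ) ≤ (M : ℝ) → M ≤ N →
        ∀ k ℓ : ℕ, k ≤ N - 1 → ℓ ≤ M - 1 →
          (Set.Icc (cgl N k) (cgl N (k + 1)) ∩
            Set.Icc (cgl M ℓ) (cgl M (ℓ + 1))).Nonempty →
          A ≤ (cgl N (k + 1) - cgl N k) / (cgl M (ℓ + 1) - cgl M ℓ) ∧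
          (cgl N (k + 1) - cgl N k) / (cgl M (ℓ + 1) - cgl M ℓ) ≤ B := by
  refine ⟨c / 2 / (1 + 2 * (1 + 1 / c)), 5, by positivity, ?_, ?_⟩
  · rw [div_le_iff₀ (by positivity)]
    have : 0 < 1 / c := by positivity
    linarith
  intro M N hM hcM hMN k ℓ hk hℓ ⟨x, hx, hx'⟩
  have hk : k < N := by omega
  have hℓ : ℓ < M := by omega
  have hM0 : (0 : ℝ) < M := by exact_mod_cast hM
  have hMN' : (M : ℝ) ≤ N := by exact_mod_cast hMN
  have hN0 : (0 : ℝ) < N := hM0.trans_le hMN'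
  have h₁ := angle_le_of_cgl_le (by omega) (by omega) hk.le hℓ (hx.1.trans hx'.2)
  have h₂ := angle_le_of_cgl_le (by omega) (by omega) hℓ.le hk (hx'.1.trans hx.2)
  have hθ := midpoint_mem_Icc hk
  have hφ := midpoint_mem_Icc hℓ
  have hh : 0 < Real.pi / (2 * N) := by positivity
  have hg : 0 < Real.pi / (2 * M) := by positivity
  have hhg : Real.pi / (2 * N) ≤ Real.pi / (2 * M) := by gcongr
  have hgh : c * (Real.pi / (2 * M)) ≤ Real.pi / (2 * N) := by
    rw [mul_div_assoc', div_le_div_iff₀ (by positivity) (by positivity)]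
    nlinarith [mul_le_mul_of_nonneg_left hcM Real.pi_pos.le]
  rw [cgl_succ_sub, cgl_succ_sub]
  push_cast at h₁ h₂
  set h := Real.pi / (2 * N)
  set g := Real.pi / (2 * M)
  set θ := (2 * (k : ℝ) + 1) * h with hθ_def
  set φ := (2 * (ℓ : ℝ) + 1) * g with hφ_def
  have hd : |θ - φ| ≤ h + g := abs_le.2 ⟨by linarith, by linarith⟩
  have hgc : g ≤ 1 / c * h := by
    rw [one_div, inv_mul_eq_div, le_div_iff₀ hc0]
    linarith
  have hup : Real.sin θ ≤ 5 * Real.sin φ := by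
    have := sin_le_mul_sin_of_abs_sub_le (r := 2) hg.le (by norm_num) hφ (hd.trans (by linarith))
    linarith
  have hlo : Real.sin φ ≤ (1 + 2 * (1 + 1 / c)) * Real.sin θ :=
    sin_le_mul_sin_of_abs_sub_le hh.le (by positivity) hθ
      (by rw [abs_sub_comm]; linarith)
  have hg2 : g ≤ Real.pi / 2 := by linarith [hφ.1, hφ.2]
  have hsg : 0 < Real.sin g := by linarith [half_le_sin hg.le hg2]
  have hsh : 0 < Real.sin h := by linarith [half_le_sin hh.le (hhg.trans hg2)]
  have hsφ : 0 < Real.sin φ := hsg.trans_le (sin_le_sin_of_mem_Icc hg.le hφ)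
  have hsθ : 0 < Real.sin θ := hsh.trans_le (sin_le_sin_of_mem_Icc hh.le hθ)
  have hs_le : Real.sin h ≤ Real.sin g :=
    Real.sin_le_sin_of_le_of_le_pi_div_two (by linarith) hg2 hhg
  have hs_ge : c / 2 * Real.sin g ≤ Real.sin h := by
    have := half_le_sin hh.le (hhg.trans hg2)
    have := mul_le_mul_of_nonneg_left (Real.sin_le hg.le) hc0.le
    linarith
  constructor
  · rw [div_le_div_iff₀ (by positivity) (by positivity)]
    have := mul_le_mul hlo hs_ge (by positivity) (by positivity)
    linarith
  · rw [div_le_iff₀ (by positivity)]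
    have := mul_le_mul hup hs_le hsh.le (by positivity)
    linarith
end
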